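/- arXiv:1511.02705 — 2 statements merged into one kernel-verified Lean document; each statement's English description precedes it below -/
import Mathlib

section
/- Let z₀ > 0 and σ_Z > 0, set s² = ln(1+σ_Z²), and define f_Z : (0,∞) → ℝ by f_Z(z) = (z₀/z)·exp(−(ln(z/z₀))²/(2s²)). Let m_Z = z₀/(1+σ_Z²) be its mode. Then there exist exactly two points 0 < z₋ < z₊ with f_Z(z₋) = f_Z(z₊) = f_Z(m_Z)/2, and the octave bandwidth B_Z = ln(z₊/z₋)/ln(2) satisfies B_Z = √(8·ln(1+σ_Z²)/ln(2)). -/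
/-- Octave bandwidth of the log-normal scale distribution: with
`f_Z(z) = (z₀/z)·exp(-(ln(z/z₀))²/(2 ln(1+σ_Z²)))` and mode `m_Z = z₀/(1+σ_Z²)`, there are
exactly two half-power cutoff points `0 < z₋ < z₊` with `f_Z(z₋) = f_Z(z₊) = f_Z(m_Z)/2`,
and the octave bandwidth satisfies `B_Z = ln(z₊/z₋)/ln 2 = √(8 ln(1+σ_Z²)/ln 2)`. -/
theorem lognormal_octave_bandwidth (z₀ σZ : ℝ) (hz₀ : 0 < z₀) (hσZ : 0 < σZ) :
    let fZ : ℝ → ℝ := fun z =>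
      (z₀ / z) * Real.exp (-(Real.log (z / z₀)) ^ 2 / (2 * Real.log (1 + σZ ^ 2)))
    let mZ : ℝ := z₀ / (1 + σZ ^ 2)
    ∃ zm zp : ℝ, 0 < zm ∧ zm < zp ∧
      fZ zm = fZ mZ / 2 ∧ fZ zp = fZ mZ / 2 ∧
      (∀ z : ℝ, 0 < z → fZ z = fZ mZ / 2 → z = zm ∨ z = zp) ∧
      Real.log (zp / zm) / Real.log 2 = Real.sqrt (8 * Real.log (1 + σZ ^ 2) / Real.log 2) := by
  intro fZ mZ
  have h1 : (1:ℝ) < 1 + σZ ^ 2 := by have := pow_pos hσZ 2; linarith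
  obtain ⟨L, hL⟩ : ∃ L, L = Real.log (1 + σZ ^ 2) := ⟨_, rfl⟩
  have hLpos : 0 < L := hL ▸ Real.log_pos h1
  have hl2 : 0 < Real.log 2 := Real.log_pos (by norm_num)
  have key : ∀ u : ℝ, fZ (z₀ * Real.exp u) = Real.exp (L / 2 - (u + L) ^ 2 / (2 * L)) := by
    intro u
    have e1 : z₀ / (z₀ * Real.exp u) = Real.exp (-u) := by
      rw [Real.exp_neg]; field_simp
    have e2 : z₀ * Real.exp u / z₀ = Real.exp u := by field_simp
    simp only [fZ]
    rw [e1, e2, Real.log_exp, ← hL, ← Real.exp_add]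
    congr 1
    field_simp
    ring
  have hm : mZ = z₀ * Real.exp (-L) := by
    simp only [mZ]
    rw [Real.exp_neg, hL, Real.exp_log (by linarith)]
    rfl
  have hhalf : fZ mZ / 2 = Real.exp (L / 2 - Real.log 2) := by
    rw [hm, key, Real.exp_sub (L / 2) (Real.log 2), Real.exp_log (by norm_num)]
    simp
  obtain ⟨D, hD⟩ : ∃ D, D = Real.sqrt (2 * L * Real.log 2) := ⟨_, rfl⟩
  have hDpos : 0 < D := hD ▸ Real.sqrt_pos.mpr (by positivity)
  have hDsq : D ^ 2 = 2 * L * Real.log 2 := by rw [hD, Real.sq_sqrt (by positivity)]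
  have iff : ∀ u : ℝ, fZ (z₀ * Real.exp u) = fZ mZ / 2 ↔ (u + L) ^ 2 = D ^ 2 := by
    intro u
    rw [key, hhalf, Real.exp_eq_exp, hDsq, sub_right_inj, div_eq_iff (by positivity)]
    constructor <;> intro h <;> linarith
  refine ⟨z₀ * Real.exp (-L - D), z₀ * Real.exp (-L + D), by positivity, ?_, ?_, ?_, ?_, ?_⟩
  · apply mul_lt_mul_of_pos_left _ hz₀
    exact Real.exp_lt_exp.mpr (by linarith)
  · rw [iff]; ring
  · rw [iff]; ring
  · intro z hz h
    have e : z = z₀ * Real.exp (Real.log (z / z₀)) := by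
      rw [Real.exp_log (by positivity)]; field_simp
    rw [e, iff, sq_eq_sq_iff_eq_or_eq_neg] at h
    rcases h with h | h
    · right
      rw [e, show Real.log (z / z₀) = -L + D by linarith]
    · left
      rw [e, show Real.log (z / z₀) = -L - D by linarith]
  · rw [mul_div_mul_left _ _ hz₀.ne', ← Real.exp_sub, Real.log_exp, ← hL]
    symm
    rw [Real.sqrt_eq_iff_mul_self_eq (by positivity)
      (div_nonneg (by linarith) hl2.le)]
    field_simp
    linear_combination -4 * hDsq
end

section
/- Let u > 0 and define r : ℝ → ℝ by r(t) = t·e^{−t/u} for t ≥ 0 and r(t) = 0 for t < 0. Then for every t ∈ ℝ, ∫_ℝ r(s)·r(s + |t|) ds = (u³/4)·(1 + |t|/u)·e^{−|t|/u}. In particular the autocorrelation r ⋆ r̄, where r̄(s) = r(−s), equals (u³/4)·(1 + |t|/u)·e^{−|t|/u} at each t ∈ ℝ. -/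
open MeasureTheory

/-- Autocorrelation of the critically damped impulse response
`r(t) = t·e^{-t/u}·1_{t≥0}`: for every `t ∈ ℝ`,
`∫ r(s)·r(s+|t|) ds = (u³/4)·(1+|t|/u)·e^{-|t|/u}`, which is the value of `r ⋆ r̄` at `t`. -/
theorem impulse_response_autocorrelation (u : ℝ) (hu : 0 < u) (t : ℝ) :
    let r : ℝ → ℝ := fun s => if 0 ≤ s then s * Real.exp (-s / u) else 0
    ∫ s : ℝ, r s * r (s + |t|)
      = (u ^ 3 / 4) * (1 + |t| / u) * Real.exp (-|t| / u) := by
  intro r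
  have ha : 0 ≤ |t| := abs_nonneg t
  generalize |t| = a at ha ⊢
  have hu0 : u ≠ 0 := hu.ne'
  have h1 : (fun s : ℝ => r s * r (s + a)) = Set.indicator (Set.Ici 0)
      (fun s => s * (s + a) * Real.exp (-(2 * s / u)) * Real.exp (-a / u)) := by
    funext s
    by_cases hs : 0 ≤ s
    · have hsa : 0 ≤ s + a := by linarith
      rw [Set.indicator_of_mem (by exact hs)]
      simp only [r, if_pos hs, if_pos hsa]
      rw [mul_assoc (s * (s + a)), ← Real.exp_add,
        show -(2 * s / u) + -a / u = -s / u + -(s + a) / u by ring, Real.exp_add]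
      ring
    · rw [Set.indicator_of_notMem (by exact hs)]
      simp only [r, if_neg hs, zero_mul]
  rw [h1, integral_indicator measurableSet_Ici, integral_Ici_eq_integral_Ioi]
  have hd : ∀ x ∈ Set.Ici (0 : ℝ), HasDerivAt
      (fun s : ℝ => -(u / 2) * (s ^ 2 + (a + u) * s + (u * a / 2 + u ^ 2 / 2))
        * Real.exp (-(2 * s / u)) * Real.exp (-a / u))
      (x * (x + a) * Real.exp (-(2 * x / u)) * Real.exp (-a / u)) x := by
    intro x _
    have e : HasDerivAt (fun s : ℝ => -(2 * s / u)) (-(2 * 1 / u)) x :=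
      (((hasDerivAt_id x).const_mul 2).div_const u).neg
    have p : HasDerivAt (fun s : ℝ => s ^ 2 + (a + u) * s + (u * a / 2 + u ^ 2 / 2))
        (2 * x + (a + u) * 1) x := by
      have := (((hasDerivAt_pow 2 x).add ((hasDerivAt_id x).const_mul (a + u))).add_const
        (u * a / 2 + u ^ 2 / 2))
      simpa using this
    have := ((p.const_mul (-(u / 2))).mul e.exp).mul_const (Real.exp (-a / u))
    refine this.congr_deriv ?_
    field_simp
    ring
  have hlin : Filter.Tendsto (fun s : ℝ => 2 * s / u) Filter.atTop Filter.atTop :=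
    (Filter.tendsto_id.const_mul_atTop two_pos).atTop_div_const hu
  have ht : Filter.Tendsto
      (fun s : ℝ => -(u / 2) * (s ^ 2 + (a + u) * s + (u * a / 2 + u ^ 2 / 2))
        * Real.exp (-(2 * s / u)) * Real.exp (-a / u)) Filter.atTop (nhds 0) := by
    have k := fun n => (Real.tendsto_pow_mul_exp_neg_atTop_nhds_zero n).comp hlin
    have := ((((k 2).const_mul (u ^ 2 / 4)).add ((k 1).const_mul ((a + u) * (u / 2)))).add
      ((k 0).const_mul (u * a / 2 + u ^ 2 / 2))).const_mul (-(u / 2) * Real.exp (-a / u))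
    simp only [mul_zero, add_zero] at this
    refine this.congr fun s => ?_
    simp only [Function.comp]
    field_simp
    ring
  rw [integral_Ioi_of_hasDerivAt_of_nonneg' hd _ ht]
  · simp
    field_simp
    ring
  · intro x hx
    have hx : 0 < x := hx
    positivity
end
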